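/- If f and g both belong to SS₀(ℝ), then the composition g ∘ f⁻¹ belongs to SS₀(ℝ); consequently SS₀(ℝ) is a group under composition of homeomorphisms. -/

import Mathlib

open MeasureTheory Set Real

noncomputable def intAvg (f : ℝ → ℝ) (a b : ℝ) : ℝ := (b - a)⁻¹ * ∫ x in Set.Ioo a b, f x

noncomputable def mosc (f : ℝ → ℝ) (a b : ℝ) : ℝ :=
  (b - a)⁻¹ * ∫ x in Set.Ioo a b, |f x - intAvg f a b|

def MemBMO (f : ℝ → ℝ) : Prop := ∃ M : ℝ, ∀ a b : ℝ, a < b → mosc f a b ≤ M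

def MemCMO (f : ℝ → ℝ) : Prop :=
  MemBMO f ∧ ∀ ε : ℝ, 0 < ε → ∃ g : ℝ → ℝ, Continuous g ∧ HasCompactSupport g ∧
    ∀ a b : ℝ, a < b → mosc (fun x => f x - g x) a b ≤ ε

/-- `h` is a strongly quasisymmetric (increasing) map of `ℝ`. -/
def StronglyQS (h : ℝ → ℝ) : Prop :=
  ∃ C₁ : ℝ, 0 < C₁ ∧ ∃ C₂ : ℝ, 0 < C₂ ∧
    ∀ a b : ℝ, a < b → ∀ A : Set ℝ, A ⊆ Set.Ioo a b → MeasurableSet A →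
      (volume (h '' A)).toReal ≤
        C₁ * (((volume A).toReal / (b - a)) ^ C₂) * (volume (h '' Set.Ioo a b)).toReal

/-- `h ∈ SS₀(ℝ)`: `h` is an increasing homeomorphism of `ℝ` onto itself which is strongly
quasisymmetric and satisfies `log h' ∈ CMO(ℝ)`. -/
def MemSS₀ (h : ℝ → ℝ) : Prop :=
  StrictMono h ∧ Continuous h ∧ Function.Surjective h ∧ StronglyQS h ∧
    MemCMO (fun x => Real.log (deriv h x))

open scoped ENNReal
open Filter Topology

namespace StronglyVanishing

/-- The left endpoint of the `k`-th dyadic interval of generation `n` based on `[a, a + L)`. -/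
noncomputable def dyadicLeft (a L : ℝ) (n : ℕ) (k : ℤ) : ℝ := a + k * (L / 2 ^ n)

/-- The index of the dyadic interval of generation `n` containing `x`. -/
noncomputable def dyadicIndex (a L : ℝ) (n : ℕ) (x : ℝ) : ℤ := ⌊(x - a) / L * 2 ^ n⌋

/-- The dyadic interval of generation `n` containing `x`. -/
def dyadicIco (a L : ℝ) (n : ℕ) (x : ℝ) : Set ℝ :=
  Ico (dyadicLeft a L n (dyadicIndex a L n x)) (dyadicLeft a L n (dyadicIndex a L n x + 1))

variable {a L : ℝ}

theorem dyadicLeft_add_one_sub (n : ℕ) (k : ℤ) :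
    dyadicLeft a L n (k + 1) - dyadicLeft a L n k = L / 2 ^ n := by
  simp only [dyadicLeft]; push_cast; ring

theorem mem_dyadic_iff (hL : 0 < L) {n : ℕ} {k : ℤ} {x : ℝ} :
    x ∈ Ico (dyadicLeft a L n k) (dyadicLeft a L n (k + 1)) ↔ dyadicIndex a L n x = k := by
  have h2 : (0 : ℝ) < 2 ^ n := by positivity
  have e : (x - a) / L * 2 ^ n = (x - a) / (L / 2 ^ n) := by field_simp
  have hp : 0 < L / 2 ^ n := by positivity
  rw [dyadicIndex, Int.floor_eq_iff, e, le_div_iff₀ hp, div_lt_iff₀ hp, mem_Ico, dyadicLeft,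
    dyadicLeft]
  push_cast
  constructor <;> rintro ⟨h, h'⟩ <;> constructor <;> linarith

theorem mem_dyadicIco (hL : 0 < L) {n : ℕ} {x y : ℝ} :
    y ∈ dyadicIco a L n x ↔ dyadicIndex a L n y = dyadicIndex a L n x :=
  mem_dyadic_iff hL

theorem self_mem_dyadicIco (hL : 0 < L) (n : ℕ) (x : ℝ) : x ∈ dyadicIco a L n x :=
  (mem_dyadicIco hL).2 rfl

theorem dyadicIndex_eq_div {m n : ℕ} (h : m ≤ n) (x : ℝ) :
    dyadicIndex a L m x = dyadicIndex a L n x / (2 ^ (n - m) : ℕ) := by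
  rw [dyadicIndex, dyadicIndex, ← Int.floor_div_natCast]
  congr 1
  push_cast
  rw [mul_div_assoc]
  congr 1
  rw [eq_div_iff (by positivity), ← pow_add, Nat.add_sub_cancel' h]

theorem dyadicIndex_congr {m n : ℕ} (h : m ≤ n) {x y : ℝ}
    (hxy : dyadicIndex a L n x = dyadicIndex a L n y) :
    dyadicIndex a L m x = dyadicIndex a L m y := by
  rw [dyadicIndex_eq_div h, dyadicIndex_eq_div h, hxy]

theorem dyadicIco_antitone (hL : 0 < L) {m n : ℕ} (h : m ≤ n) (x : ℝ) :
    dyadicIco a L n x ⊆ dyadicIco a L m x := fun _ hy =>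
  (mem_dyadicIco hL).2 (dyadicIndex_congr h ((mem_dyadicIco hL).1 hy))

theorem dyadicIco_zero (hL : 0 < L) {x : ℝ} (hx : x ∈ Ico a (a + L)) :
    dyadicIco a L 0 x = Ico a (a + L) := by
  have : dyadicIndex a L 0 x = 0 := by
    rw [← mem_dyadic_iff hL]
    simpa [dyadicLeft] using hx
  rw [dyadicIco, this]
  simp [dyadicLeft]

theorem volume_dyadicIco (n : ℕ) (x : ℝ) :
    volume (dyadicIco a L n x) = ENNReal.ofReal (L / 2 ^ n) := by
  rw [dyadicIco, Real.volume_Ico, dyadicLeft_add_one_sub]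

/-- Lebesgue differentiation along the dyadic intervals of `[a, a + L)`. -/
theorem ae_tendsto_dyadic_lintegral_div (hL : 0 < L) {F : ℝ → ℝ≥0∞} (hF : Measurable F)
    (hfin : ∫⁻ x, F x ≠ ∞) :
    ∀ᵐ x, Tendsto (fun n => (∫⁻ y in dyadicIco a L n x, F y) / volume (dyadicIco a L n x))
      atTop (𝓝 (F x)) := by
  filter_upwards [(IsUnifLocDoublingMeasure.vitaliFamily (volume : Measure ℝ)
    1).ae_tendsto_lintegral_div' hF hfin] with x hx
  set l : ℕ → ℝ := fun n => dyadicLeft a L n (dyadicIndex a L n x)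
  set r : ℕ → ℝ := fun n => dyadicLeft a L n (dyadicIndex a L n x + 1)
  have hlr : ∀ n, r n - l n = L / 2 ^ n := fun n => dyadicLeft_add_one_sub n _
  have hlim : Tendsto (fun n => (r n - l n) / 2) atTop (𝓝[>] 0) := by
    refine tendsto_nhdsWithin_iff.2 ⟨?_, Eventually.of_forall fun n => ?_⟩
    · have : Tendsto (fun n : ℕ => L / 2 * (1 / 2 : ℝ) ^ n) atTop (𝓝 (L / 2 * 0)) :=
        (tendsto_pow_atTop_nhds_zero_of_lt_one (by norm_num) (by norm_num)).const_mul _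
      rw [mul_zero] at this
      refine this.congr fun n => ?_
      rw [hlr, one_div, inv_pow]
      ring
    · rw [mem_Ioi, hlr]
      positivity
  have key := hx.comp (IsUnifLocDoublingMeasure.tendsto_closedBall_filterAt volume (K := 1)
    (fun n => (l n + r n) / 2) (fun n => (r n - l n) / 2) hlim (Eventually.of_forall fun n => by
      have h := self_mem_dyadicIco (a := a) hL n x
      rw [one_mul, ← Real.Icc_eq_closedBall]
      exact Ico_subset_Icc_self h))
  refine key.congr fun n => ?_
  simp only [Function.comp_apply]
  rw [← Real.Icc_eq_closedBall, setLIntegral_congr Ico_ae_eq_Icc.symm,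
    measure_congr Ico_ae_eq_Icc.symm]
  rfl

/-- The Calderón–Zygmund stopping-time decomposition on an interval. -/
theorem exists_calderonZygmund {F : ℝ → ℝ≥0∞} (hF : Measurable F) {a b : ℝ} (hab : a < b)
    {t : ℝ≥0∞} (ht : t ≠ ∞) (hint : ∫⁻ x in Ico a b, F x ≤ t * ENNReal.ofReal (b - a)) :
    ∃ S : Set (ℝ × ℝ), S.Countable ∧ S.PairwiseDisjoint (fun p => Ico p.1 p.2) ∧
      (∀ p ∈ S, p.1 < p.2 ∧ Ico p.1 p.2 ⊆ Ico a b ∧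
        t * ENNReal.ofReal (p.2 - p.1) ≤ ∫⁻ x in Ico p.1 p.2, F x ∧
        ∫⁻ x in Ico p.1 p.2, F x ≤ 2 * t * ENNReal.ofReal (p.2 - p.1)) ∧
      ∀ᵐ x, x ∈ Ico a b → x ∉ ⋃ p ∈ S, Ico p.1 p.2 → F x ≤ t := by
  obtain ⟨L, hL, rfl⟩ : ∃ L, 0 < L ∧ b = a + L := ⟨b - a, by linarith, by ring⟩
  rw [add_sub_cancel_left] at hint
  set B : ℕ → ℝ → Prop := fun n x =>
    t * ENNReal.ofReal (L / 2 ^ n) < ∫⁻ y in dyadicIco a L n x, F y with hB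
  have hBcongr : ∀ {m n x y}, m ≤ n → dyadicIndex a L n x = dyadicIndex a L n y →
      (B m x ↔ B m y) := by
    intro m n x y h hxy
    simp only [hB, dyadicIco, dyadicIndex_congr h hxy]
  set P : ℕ → ℝ → Prop := fun n x => B n x ∧ ∀ m < n, ¬ B m x with hP
  have hPcongr : ∀ {n x y}, dyadicIndex a L n x = dyadicIndex a L n y → P n x → P n y := by
    intro n x y h hx
    exact ⟨(hBcongr le_rfl h).1 hx.1, fun m hm hb => hx.2 m hm ((hBcongr hm.le h).2 hb)⟩
  set e : ℕ × ℤ → ℝ × ℝ := fun q => (dyadicLeft a L q.1 q.2, dyadicLeft a L q.1 (q.2 + 1)) with he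
  have hB0 : ∀ x ∈ Ico a (a + L), ¬ B 0 x := by
    intro x hx
    simp only [hB, dyadicIco_zero hL hx, pow_zero, div_one, not_lt]
    exact hint
  refine ⟨{p | ∃ n, ∃ x ∈ Ico a (a + L), P n x ∧ p = e (n, dyadicIndex a L n x)}, ?_, ?_, ?_, ?_⟩
  · refine (countable_range e).mono ?_
    rintro p ⟨n, x, -, -, rfl⟩
    exact mem_range_self _
  · rintro p ⟨n, x, -, hx, rfl⟩ q ⟨m, y, -, hy, rfl⟩ hne
    refine Set.disjoint_left.2 fun z hz hz' => hne ?_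
    have h1 : dyadicIndex a L n z = dyadicIndex a L n x := (mem_dyadic_iff hL).1 hz
    have h2 : dyadicIndex a L m z = dyadicIndex a L m y := (mem_dyadic_iff hL).1 hz'
    have hx' := hPcongr h1.symm hx
    have hy' := hPcongr h2.symm hy
    have hnm : n = m := by
      rcases lt_trichotomy n m with h | h | h
      · exact absurd hx'.1 (hy'.2 n h)
      · exact h
      · exact absurd hy'.1 (hx'.2 m h)
    subst hnm
    rw [← h1, ← h2]
  · rintro p ⟨n, x, hxI, hx, rfl⟩
    have hlen : (e (n, dyadicIndex a L n x)).2 - (e (n, dyadicIndex a L n x)).1 = L / 2 ^ n :=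
      dyadicLeft_add_one_sub n _
    have hI : Ico (e (n, dyadicIndex a L n x)).1 (e (n, dyadicIndex a L n x)).2
      = dyadicIco a L n x := rfl
    rw [hI, hlen]
    have hpos : 0 < L / 2 ^ n := by positivity
    refine ⟨by linarith, ?_, hx.1.le, ?_⟩
    · rw [← dyadicIco_zero hL hxI]
      exact dyadicIco_antitone hL (Nat.zero_le n) x
    · cases n with
      | zero => exact absurd hx.1 (hB0 x hxI)
      | succ n =>
        calc ∫⁻ y in dyadicIco a L (n + 1) x, F y ≤ ∫⁻ y in dyadicIco a L n x, F y :=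
              lintegral_mono_set (dyadicIco_antitone hL n.le_succ x)
          _ ≤ t * ENNReal.ofReal (L / 2 ^ n) := not_lt.1 (hx.2 n n.lt_succ_self)
          _ = 2 * t * ENNReal.ofReal (L / 2 ^ (n + 1)) := by
              have : L / 2 ^ n = 2 * (L / 2 ^ (n + 1)) := by rw [pow_succ]; field_simp
              rw [this, ENNReal.ofReal_mul (by norm_num), ENNReal.ofReal_ofNat]
              ring
  · have hG : Measurable ((Ico a (a + L)).indicator F) := hF.indicator measurableSet_Ico
    have hGfin : ∫⁻ x, (Ico a (a + L)).indicator F x ≠ ∞ := by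
      rw [lintegral_indicator measurableSet_Ico]
      exact (hint.trans_lt (ENNReal.mul_lt_top ht.lt_top ENNReal.ofReal_lt_top)).ne
    filter_upwards [ae_tendsto_dyadic_lintegral_div (a := a) hL hG hGfin] with x hx hxI hxU
    have hnB : ∀ n, ¬ B n x := by
      by_contra! hcon
      classical
      refine hxU (mem_biUnion (x := e (Nat.find hcon, dyadicIndex a L (Nat.find hcon) x))
        ⟨Nat.find hcon, x, hxI, ⟨Nat.find_spec hcon, fun m hm => Nat.find_min hcon hm⟩, rfl⟩
        (self_mem_dyadicIco hL _ x))
    rw [indicator_of_mem hxI] at hx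
    refine le_of_tendsto' hx fun n => ?_
    refine ENNReal.div_le_of_le_mul ?_
    rw [volume_dyadicIco]
    refine le_trans (lintegral_mono fun y => indicator_le_self _ _ _) (not_lt.1 (hnB n))

theorem mul_measure_biUnion_le {F : ℝ → ℝ≥0∞} {a b : ℝ} {t : ℝ≥0∞} {S : Set (ℝ × ℝ)}
    (hS : S.Countable) (hd : S.PairwiseDisjoint (fun p => Ico p.1 p.2))
    (hsub : ∀ p ∈ S, Ico p.1 p.2 ⊆ Ico a b)
    (hF : ∀ p ∈ S, t * ENNReal.ofReal (p.2 - p.1) ≤ ∫⁻ x in Ico p.1 p.2, F x) :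
    t * volume (⋃ p ∈ S, Ico p.1 p.2) ≤ ∫⁻ x in Ico a b, F x := by
  calc t * volume (⋃ p ∈ S, Ico p.1 p.2)
      = ∑' p : S, t * volume (Ico p.1.1 p.1.2) := by
        rw [measure_biUnion hS hd fun _ _ => measurableSet_Ico, ENNReal.tsum_mul_left]
    _ ≤ ∑' p : S, ∫⁻ x in Ico p.1.1 p.1.2, F x :=
        ENNReal.tsum_le_tsum fun p => by rw [Real.volume_Ico]; exact hF p p.2
    _ = ∫⁻ x in ⋃ p ∈ S, Ico p.1 p.2, F x :=
        (lintegral_biUnion hS (fun _ _ => measurableSet_Ico) hd F).symm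
    _ ≤ ∫⁻ x in Ico a b, F x := lintegral_mono_set (iUnion₂_subset hsub)

/-- Geometric decay of a measure that satisfies Muckenhoupt's condition at density `1 / 2`. -/
theorem measure_le_pow_mul {ν : Measure ℝ} (hac : ν ≪ volume) {θ : ℝ≥0∞}
    (h : ∀ a b : ℝ, a < b → ∀ E ⊆ Ico a b, MeasurableSet E →
      volume E ≤ 2⁻¹ * ENNReal.ofReal (b - a) → ν E ≤ θ * ν (Ico a b)) (n : ℕ) :
    ∀ a b : ℝ, a < b → ∀ E ⊆ Ico a b, MeasurableSet E →
      4 ^ n * volume E ≤ ENNReal.ofReal (b - a) → ν E ≤ θ ^ n * ν (Ico a b) := by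
  induction n with
  | zero =>
    intro a b _ E hE _ _
    simpa using measure_mono hE
  | succ n ih =>
    intro a b hab E hE hEm hvol
    have hF : Measurable (E.indicator (1 : ℝ → ℝ≥0∞)) := measurable_one.indicator hEm
    have hFint : ∀ s, ∫⁻ x in s, E.indicator (1 : ℝ → ℝ≥0∞) x = volume (E ∩ s) := fun s => by
      rw [lintegral_indicator_one hEm, Measure.restrict_apply hEm]
    have h4 : (4 : ℝ≥0∞)⁻¹ ≠ ∞ := by simp
    have h44 : (4 : ℝ≥0∞) * 4⁻¹ = 1 := ENNReal.mul_inv_cancel (by simp) (by simp)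
    obtain ⟨S, hSc, hSd, hS, hSae⟩ := exists_calderonZygmund hF hab h4 (by
      rw [hFint, inter_eq_left.2 hE, ← ENNReal.mul_le_iff_le_inv (by simp) (by simp)]
      refine le_trans ?_ hvol
      gcongr
      exact le_self_pow₀ (by norm_num) n.succ_ne_zero)
    set U := ⋃ p ∈ S, Ico p.1 p.2 with hU
    have hUm : MeasurableSet U := .biUnion hSc fun _ _ => measurableSet_Ico
    have hUsub : U ⊆ Ico a b := iUnion₂_subset fun p hp => (hS p hp).2.1
    have hUvol : volume U ≤ 4 * volume E := by
      have := mul_measure_biUnion_le hSc hSd (fun p hp => (hS p hp).2.1)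
        (fun p hp => (hS p hp).2.2.1)
      rw [hFint, inter_eq_left.2 hE] at this
      calc volume U = 4 * (4⁻¹ * volume U) := by rw [← mul_assoc, h44, one_mul]
        _ ≤ _ := by gcongr
    have hnull : volume (E \ U) = 0 := by
      rw [measure_eq_zero_iff_ae_notMem]
      filter_upwards [hSae] with x hx hxE
      have := hx (hE hxE.1) hxE.2
      rw [indicator_of_mem hxE.1, Pi.one_apply, ENNReal.one_le_inv] at this
      norm_num at this
    have hEk : ∀ p ∈ S, ν (E ∩ Ico p.1 p.2) ≤ θ * ν (Ico p.1 p.2) := by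
      intro p hp
      refine h _ _ (hS p hp).1 _ inter_subset_right (hEm.inter measurableSet_Ico) ?_
      have := (hS p hp).2.2.2
      rw [hFint] at this
      refine this.trans_eq ?_
      congr 1
      rw [show (4 : ℝ≥0∞) = 2 * 2 by norm_num, ENNReal.mul_inv (by simp) (by simp), ← mul_assoc,
        ENNReal.mul_inv_cancel (by simp) (by simp), one_mul]
    calc ν E ≤ ν (E ∩ U) + ν (E \ U) := measure_le_inter_add_sdiff ν E U
      _ = ν (⋃ p ∈ S, E ∩ Ico p.1 p.2) := by
        rw [hac hnull, add_zero, hU, inter_iUnion₂]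
      _ ≤ ∑' p : S, ν (E ∩ Ico p.1.1 p.1.2) := measure_biUnion_le ν hSc _
      _ ≤ ∑' p : S, θ * ν (Ico p.1.1 p.1.2) := ENNReal.tsum_le_tsum fun p => hEk p p.2
      _ = θ * ν U := by
        rw [ENNReal.tsum_mul_left, measure_biUnion hSc hSd fun _ _ => measurableSet_Ico]
      _ ≤ θ * (θ ^ n * ν (Ico a b)) := by
        gcongr
        refine ih a b hab U hUsub hUm (le_trans ?_ hvol)
        rw [pow_succ, mul_assoc]
        gcongr
      _ = θ ^ (n + 1) * ν (Ico a b) := by ring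

/-- The quantitative absolute continuity of `w` expressed by strong quasisymmetry. -/
def StronglyAC (w : Measure ℝ) : Prop :=
  ∃ C₁ : ℝ, 0 < C₁ ∧ ∃ C₂ : ℝ, 0 < C₂ ∧
    ∀ a b : ℝ, a < b → ∀ A : Set ℝ, A ⊆ Set.Ioo a b → MeasurableSet A →
      (w A).toReal ≤ C₁ * (((volume A).toReal / (b - a)) ^ C₂) * (w (Set.Ioo a b)).toReal

theorem StronglyAC.absolutelyContinuous {w : Measure ℝ} [IsLocallyFiniteMeasure w]
    (hw : StronglyAC w) : w ≪ volume := by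
  obtain ⟨C₁, -, C₂, hC₂, h⟩ := hw
  refine Measure.AbsolutelyContinuous.mk fun E hE h0 => ?_
  have hn : ∀ n : ℕ, w (E ∩ Ioo (-(n + 1 : ℝ)) (n + 1)) = 0 := by
    intro n
    have h0' : volume (E ∩ Ioo (-(n + 1 : ℝ)) (n + 1)) = 0 := measure_mono_null inter_subset_left h0
    have := h (-(n + 1 : ℝ)) (n + 1) (by have := n.cast_nonneg (α := ℝ); linarith) _
      inter_subset_right (hE.inter measurableSet_Ioo)
    rw [h0', ENNReal.toReal_zero, zero_div, Real.zero_rpow hC₂.ne', mul_zero, zero_mul] at this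
    refine ((ENNReal.toReal_eq_zero_iff _).1 (le_antisymm this ENNReal.toReal_nonneg)).resolve_right
      ?_
    exact (measure_ne_top_of_subset inter_subset_right measure_Ioo_lt_top.ne)
  refine measure_mono_null (fun x hx => ?_) (measure_iUnion_null hn)
  obtain ⟨n, hn⟩ := exists_nat_gt |x|
  refine mem_iUnion.2 ⟨n, hx, ?_⟩
  have := abs_lt.1 hn
  constructor <;> linarith

theorem StronglyAC.exists_small {w : Measure ℝ} [IsLocallyFiniteMeasure w]
    (hw : StronglyAC w) {η : ℝ} (hη : 0 < η) :
    ∃ δ : ℝ, 0 < δ ∧ δ < 1 ∧ ∀ a b : ℝ, a < b → ∀ A ⊆ Ico a b, MeasurableSet A →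
      volume A ≤ ENNReal.ofReal δ * ENNReal.ofReal (b - a) →
      w A ≤ ENNReal.ofReal η * w (Ico a b) := by
  have hac := hw.absolutelyContinuous
  obtain ⟨C₁, hC₁, C₂, hC₂, h⟩ := hw
  have hq : 0 < η / C₁ := by positivity
  refine ⟨min ((η / C₁) ^ C₂⁻¹) (1 / 2), by positivity,
    (min_le_right _ _).trans_lt (by norm_num), fun a b hab A hA hAm hvol => ?_⟩
  set δ := min ((η / C₁) ^ C₂⁻¹) (1 / 2)
  have hδ : 0 < δ := by positivity
  have hba : 0 < b - a := by linarith
  have hA' : A =ᵐ[volume] (A ∩ Ioo a b : Set ℝ) := by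
    conv_lhs => rw [← inter_eq_left.2 hA]
    exact (ae_eq_refl A).inter Ioo_ae_eq_Ico.symm
  have hI : w (Ioo a b) = w (Ico a b) := measure_congr (hac.ae_eq Ioo_ae_eq_Ico)
  have hfin : w (Ioo a b) ≠ ∞ := measure_Ioo_lt_top.ne
  rw [measure_congr (hac.ae_eq hA'), ← hI]
  rw [measure_congr hA'] at hvol
  have hr : (volume (A ∩ Ioo a b)).toReal / (b - a) ≤ δ := by
    rw [div_le_iff₀ hba]
    rw [← ENNReal.ofReal_mul hδ.le] at hvol
    exact ENNReal.toReal_le_of_le_ofReal (by positivity) hvol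
  have hle := h a b hab _ inter_subset_right (hAm.inter measurableSet_Ioo)
  rw [← ENNReal.ofReal_toReal hfin, ← ENNReal.ofReal_mul hη.le]
  refine ENNReal.le_ofReal_iff_toReal_le (measure_ne_top_of_subset inter_subset_right measure_Ioo_lt_top.ne)
    (by positivity) |>.2 (hle.trans ?_)
  gcongr
  calc C₁ * ((volume (A ∩ Ioo a b)).toReal / (b - a)) ^ C₂ ≤ C₁ * ((η / C₁) ^ C₂⁻¹) ^ C₂ := by
        gcongr
        exact hr.trans (min_le_left _ _)
    _ = η := by
        rw [← Real.rpow_mul hq.le, inv_mul_cancel₀ hC₂.ne', Real.rpow_one]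
        field_simp

/-- A strong form of Muckenhoupt's condition forces Lebesgue measure to be absolutely
continuous. -/
theorem volume_absolutelyContinuous {w : Measure ℝ} [IsLocallyFiniteMeasure w]
    (hpos : ∀ a b : ℝ, a < b → w (Ico a b) ≠ 0) {δ : ℝ} (hδ : 0 < δ) (hδ1 : δ < 1)
    (h : ∀ a b : ℝ, a < b → ∀ A ⊆ Ico a b, MeasurableSet A →
      volume A ≤ ENNReal.ofReal δ * ENNReal.ofReal (b - a) →
      w A ≤ ENNReal.ofReal 2⁻¹ * w (Ico a b)) : volume ≪ w := by
  refine Measure.AbsolutelyContinuous.mk fun A hA hwA => ?_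
  rw [measure_eq_zero_iff_ae_notMem]
  filter_upwards [Besicovitch.ae_tendsto_measure_inter_div_of_measurableSet volume hA] with x hx hxA
  rw [indicator_of_mem hxA, Pi.one_apply] at hx
  have hev := hx.eventually (lt_mem_nhds (show ENNReal.ofReal (1 - δ) < 1 by
    rw [ENNReal.ofReal_lt_one]; linarith))
  obtain ⟨r, hr, hr0⟩ := (hev.and self_mem_nhdsWithin).exists
  replace hr0 : 0 < r := hr0
  set a := x - r with ha
  set b := x + r with hb
  have hab : a < b := by linarith
  rw [Real.closedBall_eq_Icc, ← ha, ← hb, Real.volume_Icc,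
    measure_congr ((ae_eq_refl A).inter (Ico_ae_eq_Icc (a := a) (b := b)).symm)] at hr
  have hba : 0 < b - a := by linarith
  have hr' : ENNReal.ofReal (1 - δ) * ENNReal.ofReal (b - a) ≤ volume (A ∩ Ico a b) := by
    refine (ENNReal.le_div_iff_mul_le (Or.inl ?_) (Or.inl ENNReal.ofReal_ne_top)).1 hr.le
    simpa using hba
  have hsplit : volume (Ico a b \ A) ≤ ENNReal.ofReal δ * ENNReal.ofReal (b - a) := by
    rw [← ENNReal.add_le_add_iff_left (a := volume (Ico a b ∩ A))
      (measure_ne_top_of_subset inter_subset_left measure_Ico_lt_top.ne),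
      measure_inter_add_sdiff _ hA, Real.volume_Ico, inter_comm]
    calc ENNReal.ofReal (b - a)
        = ENNReal.ofReal (1 - δ) * ENNReal.ofReal (b - a)
          + ENNReal.ofReal δ * ENNReal.ofReal (b - a) := by
          rw [← add_mul, ← ENNReal.ofReal_add (by linarith) hδ.le, sub_add_cancel,
            ENNReal.ofReal_one, one_mul]
      _ ≤ _ := by gcongr
  have hw := h a b hab _ sdiff_subset (measurableSet_Ico.diff hA) hsplit
  have hle : w (Ico a b) ≤ ENNReal.ofReal 2⁻¹ * w (Ico a b) := by
    calc w (Ico a b) = w (Ico a b ∩ A) + w (Ico a b \ A) := (measure_inter_add_sdiff _ hA).symm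
      _ = w (Ico a b \ A) := by rw [measure_mono_null inter_subset_right hwA, zero_add]
      _ ≤ _ := hw
  have hfin : w (Ico a b) ≠ ∞ := measure_Ico_lt_top.ne
  have hlt : ENNReal.ofReal 2⁻¹ * w (Ico a b) < 1 * w (Ico a b) := by
    refine ENNReal.mul_lt_mul_left (hpos a b hab) hfin ?_
    rw [ENNReal.ofReal_lt_one]; norm_num
  rw [one_mul] at hlt
  exact absurd hle hlt.not_ge

theorem StronglyAC.of_half {ν : Measure ℝ} [IsLocallyFiniteMeasure ν] (hac : ν ≪ volume) {θ : ℝ}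
    (hθ : 0 < θ) (hθ1 : θ < 1)
    (h : ∀ a b : ℝ, a < b → ∀ E ⊆ Ico a b, MeasurableSet E →
      volume E ≤ 2⁻¹ * ENNReal.ofReal (b - a) → ν E ≤ ENNReal.ofReal θ * ν (Ico a b)) :
    StronglyAC ν := by
  have hc : 0 < Real.logb 4⁻¹ θ :=
    Real.logb_pos_of_base_lt_one (by norm_num) (by norm_num) hθ hθ1
  refine ⟨θ⁻¹, by positivity, Real.logb 4⁻¹ θ, hc, fun a b hab A hA hAm => ?_⟩
  have hba : 0 < b - a := by linarith
  set r := (volume A).toReal / (b - a) with hr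
  have hAfin : volume A ≠ ∞ := measure_ne_top_of_subset hA measure_Ioo_lt_top.ne
  have hr0 : 0 ≤ r := by positivity
  have hνI : ν (Ico a b) = ν (Ioo a b) := measure_congr (hac.ae_eq Ioo_ae_eq_Ico.symm)
  rcases hr0.eq_or_lt with h0 | hpos
  · have hA0 : volume A = 0 := by
      rcases div_eq_zero_iff.1 (hr.symm.trans h0.symm) with h | h
      · exact ((ENNReal.toReal_eq_zero_iff _).1 h).resolve_right hAfin
      · exact absurd h hba.ne'
    rw [hac hA0, ENNReal.toReal_zero]
    positivity
  · have hr1 : r ≤ 1 := by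
      rw [hr, div_le_one hba]
      refine ENNReal.toReal_le_of_le_ofReal hba.le ?_
      rw [← Real.volume_Ioo]
      exact measure_mono hA
    obtain ⟨n, hn, hn'⟩ := exists_nat_pow_near_of_lt_one hpos hr1
      (show (0 : ℝ) < 4⁻¹ by norm_num) (by norm_num)
    have hvol : 4 ^ n * volume A ≤ ENNReal.ofReal (b - a) := by
      rw [← ENNReal.ofReal_toReal hAfin,
        show (4 : ℝ≥0∞) ^ n = ENNReal.ofReal (4 ^ n) by
          rw [ENNReal.ofReal_pow (by norm_num), ENNReal.ofReal_ofNat],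
        ← ENNReal.ofReal_mul (by positivity)]
      refine ENNReal.ofReal_le_ofReal ?_
      rw [hr, div_le_iff₀ hba, inv_pow] at hn'
      rwa [← le_inv_mul_iff₀ (by positivity)]
    have key := measure_le_pow_mul hac h n a b hab A (hA.trans Ioo_subset_Ico_self) hAm hvol
    rw [hνI] at key
    have hfin : ν (Ioo a b) ≠ ∞ := measure_Ioo_lt_top.ne
    have key' : (ν A).toReal ≤ θ ^ n * (ν (Ioo a b)).toReal := by
      have := ENNReal.toReal_mono (ENNReal.mul_ne_top (by simp) hfin) key
      rwa [ENNReal.toReal_mul, ENNReal.toReal_pow, ENNReal.toReal_ofReal hθ.le] at this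
    refine key'.trans ?_
    gcongr
    calc θ ^ n = θ⁻¹ * θ ^ (n + 1) := by rw [pow_succ]; field_simp
      _ = θ⁻¹ * ((4⁻¹ : ℝ) ^ (n + 1)) ^ Real.logb 4⁻¹ θ := by
        rw [← Real.rpow_natCast (4⁻¹ : ℝ), ← Real.rpow_mul (by norm_num), mul_comm ((n + 1 : ℕ) : ℝ),
          Real.rpow_mul (by norm_num), Real.rpow_logb (by norm_num) (by norm_num) hθ,
          Real.rpow_natCast]
      _ ≤ θ⁻¹ * r ^ Real.logb 4⁻¹ θ := by gcongr

instance isLocallyFiniteMeasure_map (e : ℝ ≃o ℝ) :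
    IsLocallyFiniteMeasure ((volume : Measure ℝ).map e) := by
  refine ⟨fun x => ⟨Ioo (x - 1) (x + 1), Ioo_mem_nhds (by linarith) (by linarith), ?_⟩⟩
  rw [Measure.map_apply e.continuous.measurable measurableSet_Ioo, e.preimage_Ioo]
  exact measure_Ioo_lt_top

theorem map_symm_apply (e : ℝ ≃o ℝ) {A : Set ℝ} (hA : MeasurableSet A) :
    (volume : Measure ℝ).map e.symm A = volume (e '' A) := by
  rw [Measure.map_apply e.symm.continuous.measurable hA, e.image_eq_preimage_symm]

theorem map_symm_Ico (e : ℝ ≃o ℝ) (a b : ℝ) :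
    (volume : Measure ℝ).map e.symm (Ico a b) = ENNReal.ofReal (e b - e a) := by
  rw [map_symm_apply e measurableSet_Ico, e.image_Ico, Real.volume_Ico]

theorem stronglyQS_iff (e : ℝ ≃o ℝ) :
    StronglyQS e ↔ StronglyAC ((volume : Measure ℝ).map e.symm) := by
  unfold StronglyQS StronglyAC
  simp only [map_symm_apply e measurableSet_Ioo]
  refine exists_congr fun C₁ => and_congr_right fun _ => exists_congr fun C₂ =>
    and_congr_right fun _ => forall₂_congr fun a b => forall_congr' fun _ => forall₂_congr
    fun A _ => forall_congr' fun hA => ?_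
  rw [map_symm_apply e hA]

theorem volume_absolutelyContinuous_map_symm {e : ℝ ≃o ℝ} (he : StronglyQS e) :
    volume ≪ (volume : Measure ℝ).map e.symm := by
  obtain ⟨δ, hδ, hδ1, h⟩ := ((stronglyQS_iff e).1 he).exists_small (η := 2⁻¹) (by norm_num)
  refine volume_absolutelyContinuous (fun a b hab => ?_) hδ hδ1 h
  rw [map_symm_Ico]
  simpa using hab

theorem map_absolutelyContinuous {e : ℝ ≃o ℝ} (he : StronglyQS e) :
    (volume : Measure ℝ).map e ≪ volume := by
  refine Measure.AbsolutelyContinuous.mk fun B hB h0 => ?_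
  rw [Measure.map_apply e.continuous.measurable hB]
  refine volume_absolutelyContinuous_map_symm he ?_
  rwa [map_symm_apply e (e.continuous.measurable hB), e.image_preimage]

/-- The inverse of a strongly quasisymmetric homeomorphism is strongly quasisymmetric. -/
theorem stronglyQS_symm {e : ℝ ≃o ℝ} (he : StronglyQS e) : StronglyQS e.symm := by
  rw [stronglyQS_iff, OrderIso.symm_symm]
  obtain ⟨δ, hδ, hδ1, h⟩ := ((stronglyQS_iff e).1 he).exists_small (η := 4⁻¹) (by norm_num)
  refine StronglyAC.of_half (map_absolutelyContinuous he) (θ := 1 - δ) (by linarith) (by linarith)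
    fun c d hcd B hB hBm hvol => ?_
  set A := e ⁻¹' B with hA
  have hAm : MeasurableSet A := e.continuous.measurable hBm
  have hAB : e '' A = B := e.image_preimage B
  have hI : e ⁻¹' Ico c d = Ico (e.symm c) (e.symm d) := e.preimage_Ico c d
  have hlt : e.symm c < e.symm d := e.symm.strictMono hcd
  rw [Measure.map_apply e.continuous.measurable hBm,
    Measure.map_apply e.continuous.measurable measurableSet_Ico, hI, Real.volume_Ico]
  have hIe : e '' Ico (e.symm c) (e.symm d) = Ico c d := by rw [← hI, e.image_preimage]
  by_contra! hcon
  set I := Ico (e.symm c) (e.symm d)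
  have hAI : A ⊆ I := by rw [← hI]; exact preimage_mono hB
  have hAfin : volume A ≠ ∞ := measure_ne_top_of_subset hAI measure_Ico_lt_top.ne
  have hdiff : volume (I \ A) ≤ ENNReal.ofReal δ * ENNReal.ofReal (e.symm d - e.symm c) := by
    rw [← ENNReal.add_le_add_iff_left hAfin, measure_add_sdiff hAm.nullMeasurableSet,
      union_eq_self_of_subset_left hAI, Real.volume_Ico]
    calc ENNReal.ofReal (e.symm d - e.symm c)
        = ENNReal.ofReal (1 - δ) * ENNReal.ofReal (e.symm d - e.symm c)
          + ENNReal.ofReal δ * ENNReal.ofReal (e.symm d - e.symm c) := by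
          rw [← add_mul, ← ENNReal.ofReal_add (by linarith) hδ.le, sub_add_cancel,
            ENNReal.ofReal_one, one_mul]
      _ ≤ _ := by gcongr
  have hw := h _ _ hlt _ sdiff_subset (measurableSet_Ico.diff hAm) hdiff
  rw [map_symm_apply e (measurableSet_Ico.diff hAm), map_symm_Ico, e.apply_symm_apply,
    e.apply_symm_apply, image_sdiff e.injective, hAB, hIe] at hw
  have hcd' : ENNReal.ofReal (d - c) ≤ ENNReal.ofReal (3 / 4 * (d - c)) := by
    calc ENNReal.ofReal (d - c) = volume (Ico c d) := Real.volume_Ico.symm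
      _ ≤ volume B + volume (Ico c d \ B) := by
        rw [measure_add_sdiff hBm.nullMeasurableSet]
        exact measure_mono subset_union_right
      _ ≤ ENNReal.ofReal 2⁻¹ * ENNReal.ofReal (d - c)
          + ENNReal.ofReal 4⁻¹ * ENNReal.ofReal (d - c) := by
        gcongr
        simpa [ENNReal.ofReal_inv_of_pos] using hvol
      _ = _ := by
        rw [← add_mul, ← ENNReal.ofReal_add (by norm_num) (by norm_num),
          ← ENNReal.ofReal_mul (by norm_num)]
        norm_num
  rw [ENNReal.ofReal_le_ofReal_iff (by linarith)] at hcd'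
  linarith

theorem StronglyQS.comp {g f : ℝ ≃o ℝ} (hg : StronglyQS g) (hf : StronglyQS f) :
    StronglyQS (g ∘ f) := by
  obtain ⟨C, hC, c, hc, h⟩ := hg
  obtain ⟨C', hC', c', hc', h'⟩ := hf
  refine ⟨C * C' ^ c, by positivity, c' * c, by positivity, fun a b hab A hA hAm => ?_⟩
  have hba : 0 < b - a := by linarith
  have hfab : 0 < f b - f a := sub_pos.2 (f.strictMono hab)
  have hfI : f '' Ioo a b = Ioo (f a) (f b) := f.image_Ioo a b
  have hfAm : MeasurableSet (f '' A) := by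
    rw [f.image_eq_preimage_symm]
    exact f.symm.continuous.measurable hAm
  have h1 := h (f a) (f b) (f.strictMono hab) (f '' A) (by rw [← hfI]; exact image_mono hA) hfAm
  have h2 := h' a b hab A hA hAm
  rw [hfI, Real.volume_Ioo, ENNReal.toReal_ofReal hfab.le] at h2
  rw [image_comp, image_comp, hfI]
  refine h1.trans (mul_le_mul_of_nonneg_right ?_ ENNReal.toReal_nonneg)
  rw [mul_assoc]
  gcongr
  rw [Real.rpow_mul (by positivity), ← Real.mul_rpow (by positivity) (by positivity)]
  gcongr
  rwa [div_le_iff₀ hfab]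

theorem lintegral_enorm_sub_intAvg {v : ℝ → ℝ} {a b : ℝ} (hab : a < b)
    (hv : IntegrableOn v (Ico a b)) :
    ∫⁻ x in Ico a b, ‖v x - intAvg v a b‖ₑ = ENNReal.ofReal (mosc v a b * (b - a)) := by
  have hint : Integrable (fun x => v x - intAvg v a b) (volume.restrict (Ico a b)) :=
    hv.sub (integrableOn_const (by simp))
  rw [← ofReal_integral_norm_eq_lintegral_enorm hint, mosc, ← integral_Ico_eq_integral_Ioo]
  have : b - a ≠ 0 := by linarith
  congr 1
  simp only [Real.norm_eq_abs]
  field_simp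

theorem enorm_intAvg_sub_mul_le {v : ℝ → ℝ} {a b : ℝ} (hab : a < b)
    (hv : IntegrableOn v (Ico a b)) (c : ℝ) :
    ‖intAvg v a b - c‖ₑ * ENNReal.ofReal (b - a) ≤ ∫⁻ x in Ico a b, ‖v x - c‖ₑ := by
  have hba : 0 < b - a := by linarith
  have e : (intAvg v a b - c) * (b - a) = ∫ x in Ico a b, (v x - c) := by
    rw [integral_sub hv (integrableOn_const (by simp)), setIntegral_const, intAvg,
      integral_Ico_eq_integral_Ioo, Real.volume_real_Ico_of_le hab.le, smul_eq_mul]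
    field_simp
  calc ‖intAvg v a b - c‖ₑ * ENNReal.ofReal (b - a)
      = ‖(intAvg v a b - c) * (b - a)‖ₑ := by rw [enorm_mul, Real.enorm_of_nonneg hba.le]
    _ ≤ _ := by rw [e]; exact enorm_integral_le_lintegral_enorm _

section WeightedOscillation

variable {w : Measure ℝ} {δ ε : ℝ} {v : ℝ → ℝ}

/-- One Calderón–Zygmund step in the comparison of weighted and unweighted oscillation. -/
theorem lintegral_min_oscillation_step (hac : w ≪ volume) (hδ : 0 < δ) (hδ1 : δ < 1)
    (h : ∀ a b : ℝ, a < b → ∀ A ⊆ Ico a b, MeasurableSet A →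
      volume A ≤ ENNReal.ofReal δ * ENNReal.ofReal (b - a) → w A ≤ 2⁻¹ * w (Ico a b))
    (hv : Measurable v) (hloc : ∀ a b, IntegrableOn v (Ico a b)) (hε : 0 < ε)
    (hosc : ∀ a b : ℝ, a < b → mosc v a b ≤ ε) {N K : ℝ≥0∞}
    (hK : ∀ a b : ℝ, a < b →
      ∫⁻ x in Ico a b, min ‖v x - intAvg v a b‖ₑ N ∂w ≤ K * w (Ico a b))
    {a b : ℝ} (hab : a < b) :
    ∫⁻ x in Ico a b, min ‖v x - intAvg v a b‖ₑ N ∂w ≤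
      (2 * ENNReal.ofReal (ε / δ) + 2⁻¹ * K) * w (Ico a b) := by
  set t := ENNReal.ofReal (ε / δ) with ht
  have ht0 : t ≠ 0 := by simpa [ht] using div_pos hε hδ
  have htt : t ≠ ∞ := ENNReal.ofReal_ne_top
  have hba : 0 < b - a := by linarith
  set c := intAvg v a b with hc
  have hF : Measurable fun x => ‖v x - c‖ₑ := (hv.sub_const c).enorm
  have htδ : t * ENNReal.ofReal δ = ENNReal.ofReal ε := by
    rw [ht, ← ENNReal.ofReal_mul (by positivity), div_mul_cancel₀ _ hδ.ne']
  have hint : ∫⁻ x in Ico a b, ‖v x - c‖ₑ ≤ t * (ENNReal.ofReal δ * ENNReal.ofReal (b - a)) := by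
    rw [lintegral_enorm_sub_intAvg hab (hloc a b), ← mul_assoc, htδ, ← ENNReal.ofReal_mul hε.le]
    exact ENNReal.ofReal_le_ofReal (mul_le_mul_of_nonneg_right (hosc a b hab) hba.le)
  obtain ⟨S, hSc, hSd, hS, hSae⟩ := exists_calderonZygmund hF hab htt (hint.trans (by
    gcongr
    exact mul_le_of_le_one_left (zero_le) (ENNReal.ofReal_le_one.2 hδ1.le)))
  set U := ⋃ p ∈ S, Ico p.1 p.2 with hU
  have hUm : MeasurableSet U := .biUnion hSc fun _ _ => measurableSet_Ico
  have hUsub : U ⊆ Ico a b := iUnion₂_subset fun p hp => (hS p hp).2.1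
  have hwU : w U ≤ 2⁻¹ * w (Ico a b) := by
    refine h a b hab U hUsub hUm ((ENNReal.mul_le_mul_iff_right ht0 htt).1 ?_)
    exact (mul_measure_biUnion_le hSc hSd (fun p hp => (hS p hp).2.1)
      (fun p hp => (hS p hp).2.2.1)).trans hint
  have hgood : ∫⁻ x in Ico a b \ U, min ‖v x - c‖ₑ N ∂w ≤ t * w (Ico a b \ U) := by
    rw [← setLIntegral_const]
    refine setLIntegral_mono_ae measurable_const.aemeasurable ?_
    filter_upwards [hac.ae_le hSae] with x hx hxm
    exact (min_le_left _ _).trans (hx hxm.1 hxm.2)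
  have hbad : ∀ p ∈ S, ∫⁻ x in Ico p.1 p.2, min ‖v x - c‖ₑ N ∂w
      ≤ (2 * t + K) * w (Ico p.1 p.2) := by
    intro p hp
    obtain ⟨hlt, -, -, hup⟩ := hS p hp
    have havg : ‖intAvg v p.1 p.2 - c‖ₑ ≤ 2 * t := by
      have h0 : ENNReal.ofReal (p.2 - p.1) ≠ 0 := by simpa using hlt
      exact (ENNReal.mul_le_mul_iff_left h0 ENNReal.ofReal_ne_top).1
        ((enorm_intAvg_sub_mul_le hlt (hloc _ _) c).trans hup)
    calc ∫⁻ x in Ico p.1 p.2, min ‖v x - c‖ₑ N ∂w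
        ≤ ∫⁻ x in Ico p.1 p.2, (2 * t + min ‖v x - intAvg v p.1 p.2‖ₑ N) ∂w := by
          refine lintegral_mono fun x => ?_
          have htri : ‖v x - c‖ₑ ≤ 2 * t + ‖v x - intAvg v p.1 p.2‖ₑ := by
            calc ‖v x - c‖ₑ = ‖(intAvg v p.1 p.2 - c) + (v x - intAvg v p.1 p.2)‖ₑ := by
                  congr 1; ring
              _ ≤ _ := (enorm_add_le _ _).trans (by gcongr)
          rcases le_total ‖v x - intAvg v p.1 p.2‖ₑ N with h' | h'
          · rw [min_eq_left h']
            exact (min_le_left _ _).trans htri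
          · rw [min_eq_right h']
            exact (min_le_right _ _).trans le_add_self
      _ ≤ _ := by
          rw [lintegral_add_left measurable_const, setLIntegral_const, add_mul]
          gcongr
          exact hK _ _ hlt
  calc ∫⁻ x in Ico a b, min ‖v x - c‖ₑ N ∂w
      = ∫⁻ x in U, min ‖v x - c‖ₑ N ∂w + ∫⁻ x in Ico a b \ U, min ‖v x - c‖ₑ N ∂w := by
        rw [← lintegral_inter_add_sdiff _ (Ico a b) hUm, inter_eq_right.2 hUsub]
    _ ≤ (2 * t + K) * w U + t * w (Ico a b \ U) := by
        refine add_le_add ?_ hgood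
        rw [hU, lintegral_biUnion hSc (fun _ _ => measurableSet_Ico) hSd,
          measure_biUnion hSc hSd fun _ _ => measurableSet_Ico, ← ENNReal.tsum_mul_left]
        exact ENNReal.tsum_le_tsum fun p => hbad p p.2
    _ ≤ (2 * t + K) * w U + 2 * t * w (Ico a b \ U) := by
        gcongr
        exact le_mul_of_one_le_left (zero_le) one_le_two
    _ = 2 * t * (w U + w (Ico a b \ U)) + K * w U := by ring
    _ ≤ 2 * t * w (Ico a b) + K * (2⁻¹ * w (Ico a b)) := by
        gcongr
        rw [measure_add_sdiff hUm.nullMeasurableSet, union_eq_self_of_subset_left hUsub]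
    _ = _ := by ring

/-- The mean oscillation of a `BMO` function with respect to a Muckenhoupt weight is controlled by
its seminorm. -/
theorem lintegral_oscillation_le (hac : w ≪ volume) (hδ : 0 < δ) (hδ1 : δ < 1)
    (h : ∀ a b : ℝ, a < b → ∀ A ⊆ Ico a b, MeasurableSet A →
      volume A ≤ ENNReal.ofReal δ * ENNReal.ofReal (b - a) → w A ≤ 2⁻¹ * w (Ico a b))
    (hv : Measurable v) (hloc : ∀ a b, IntegrableOn v (Ico a b)) (hε : 0 < ε)
    (hosc : ∀ a b : ℝ, a < b → mosc v a b ≤ ε) {a b : ℝ} (hab : a < b) :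
    ∫⁻ x in Ico a b, ‖v x - intAvg v a b‖ₑ ∂w ≤ 4 * ENNReal.ofReal (ε / δ) * w (Ico a b) := by
  have hiter : ∀ N j : ℕ, ∀ a b : ℝ, a < b →
      ∫⁻ x in Ico a b, min ‖v x - intAvg v a b‖ₑ N ∂w
        ≤ (4 * ENNReal.ofReal (ε / δ) + 2⁻¹ ^ j * N) * w (Ico a b) := by
    intro N j
    induction j with
    | zero =>
      intro a b _
      calc ∫⁻ x in Ico a b, min ‖v x - intAvg v a b‖ₑ N ∂w ≤ ∫⁻ x in Ico a b, (N : ℝ≥0∞) ∂w :=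
            lintegral_mono fun x => min_le_right _ _
        _ ≤ _ := by
            rw [setLIntegral_const, pow_zero, one_mul]
            gcongr
            exact le_add_self
    | succ j ih =>
      intro a b hab
      refine (lintegral_min_oscillation_step hac hδ hδ1 h hv hloc hε hosc ih hab).trans_eq ?_
      congr 1
      have h4 : (2⁻¹ : ℝ≥0∞) * 4 = 2 := by
        rw [show (4 : ℝ≥0∞) = 2 * 2 by norm_num, ← mul_assoc,
          ENNReal.inv_mul_cancel (by simp) (by simp), one_mul]
      rw [mul_add, ← mul_assoc, h4, ← add_assoc, ← add_mul, ← mul_assoc, ← pow_succ']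
      norm_num
  have htrunc : ∀ N : ℕ, ∫⁻ x in Ico a b, min ‖v x - intAvg v a b‖ₑ N ∂w
      ≤ 4 * ENNReal.ofReal (ε / δ) * w (Ico a b) := by
    intro N
    have hlim : Tendsto (fun j : ℕ => (4 * ENNReal.ofReal (ε / δ) + 2⁻¹ ^ j * N) * w (Ico a b))
        atTop (𝓝 ((4 * ENNReal.ofReal (ε / δ) + 0 * N) * w (Ico a b))) := by
      refine ENNReal.Tendsto.mul_const (tendsto_const_nhds.add
        (ENNReal.Tendsto.mul_const ?_ (Or.inr (by simp)))) (Or.inl ?_)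
      · exact ENNReal.tendsto_pow_atTop_nhds_zero_of_lt_one (by simp)
      · rw [zero_mul, add_zero]
        exact mul_ne_zero four_ne_zero (ENNReal.ofReal_pos.2 (div_pos hε hδ)).ne'
    rw [zero_mul, add_zero] at hlim
    exact ge_of_tendsto' hlim fun j => hiter N j a b hab
  have hsup : ∀ x, ‖v x - intAvg v a b‖ₑ = ⨆ N : ℕ, min ‖v x - intAvg v a b‖ₑ N := by
    intro x
    have := inf_iSup_eq ‖v x - intAvg v a b‖ₑ (fun N : ℕ => (N : ℝ≥0∞))
    rwa [ENNReal.iSup_natCast, inf_top_eq] at this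
  rw [lintegral_congr hsup, lintegral_iSup (fun N => ((hv.sub_const _).enorm.min measurable_const))
    (fun m n hmn x => min_le_min le_rfl (by exact_mod_cast hmn))]
  exact iSup_le htrunc

end WeightedOscillation

theorem lintegral_deriv_eq_volume_image (e : ℝ ≃o ℝ) {A : Set ℝ} (hA : MeasurableSet A)
    (hd : ∀ x ∈ A, DifferentiableAt ℝ e x) :
    ∫⁻ x in A, ENNReal.ofReal (deriv e x) = volume (e '' A) :=
  lintegral_deriv_eq_volume_image_of_monotoneOn hA
    (fun x hx => (hd x hx).hasDerivAt.hasDerivWithinAt) (e.monotone.monotoneOn A)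

theorem ae_deriv_pos {e : ℝ ≃o ℝ} (he : StronglyQS e) :
    ∀ᵐ x, DifferentiableAt ℝ e x ∧ 0 < deriv e x := by
  have hZm : MeasurableSet ({x | DifferentiableAt ℝ e x} ∩ deriv e ⁻¹' {0}) :=
    (measurableSet_of_differentiableAt ℝ e).inter (measurable_deriv e (measurableSet_singleton 0))
  have hZ : volume ({x | DifferentiableAt ℝ e x} ∩ deriv e ⁻¹' {0}) = 0 := by
    refine volume_absolutelyContinuous_map_symm he ?_
    rw [map_symm_apply e hZm, ← lintegral_deriv_eq_volume_image e hZm fun x hx => hx.1]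
    exact setLIntegral_eq_zero hZm fun x hx => by simp [show deriv e x = 0 from hx.2]
  filter_upwards [e.monotone.ae_differentiableAt, measure_eq_zero_iff_ae_notMem.1 hZ] with x hx hxZ
  exact ⟨hx, (e.monotone.deriv_nonneg).lt_of_ne' fun h => hxZ ⟨hx, h⟩⟩

theorem exists_volume_deriv_lt_exp_le {e : ℝ ≃o ℝ} (he : StronglyQS e) {a b : ℝ} (hab : a < b) :
    ∃ D c : ℝ, 0 < c ∧ ∀ t : ℝ,
      volume {x | x ∈ Ioo a b ∧ DifferentiableAt ℝ e x ∧ deriv e x < exp (-t)}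
        ≤ ENNReal.ofReal (D * exp (-c * t)) := by
  obtain ⟨C, hC, c, hc, h⟩ := stronglyQS_symm he
  have hba : 0 < b - a := by linarith
  have heab : 0 < e b - e a := sub_pos.2 (e.strictMono hab)
  refine ⟨C * ((b - a) / (e b - e a)) ^ c * (b - a), c, hc, fun t => ?_⟩
  set A := {x | x ∈ Ioo a b ∧ DifferentiableAt ℝ e x ∧ deriv e x < exp (-t)} with hA
  have hAm : MeasurableSet A := measurableSet_Ioo.inter
    ((measurableSet_of_differentiableAt ℝ e).inter (measurable_deriv e measurableSet_Iio))
  have hAI : A ⊆ Ioo a b := fun x hx => hx.1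
  have hAfin : volume A ≠ ∞ := measure_ne_top_of_subset hAI measure_Ioo_lt_top.ne
  have himage : volume (e '' A) ≤ ENNReal.ofReal (exp (-t) * (b - a)) := by
    rw [← lintegral_deriv_eq_volume_image e hAm fun x hx => hx.2.1]
    calc ∫⁻ x in A, ENNReal.ofReal (deriv e x) ≤ ∫⁻ _ in A, ENNReal.ofReal (exp (-t)) :=
          setLIntegral_mono measurable_const fun x hx => ENNReal.ofReal_le_ofReal hx.2.2.le
      _ = ENNReal.ofReal (exp (-t)) * volume A := setLIntegral_const _ _
      _ ≤ ENNReal.ofReal (exp (-t)) * volume (Ioo a b) := by gcongr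
      _ = _ := by rw [Real.volume_Ioo, ← ENNReal.ofReal_mul (exp_pos _).le]
  have heAm : MeasurableSet (e '' A) := by
    rw [e.image_eq_preimage_symm]
    exact e.symm.continuous.measurable hAm
  have key := h (e a) (e b) (e.strictMono hab) (e '' A)
    (by rw [← e.image_Ioo]; exact image_mono hAI) heAm
  rw [e.symm.image_Ioo, e.symm_image_image, e.symm_apply_apply, e.symm_apply_apply, Real.volume_Ioo,
    ENNReal.toReal_ofReal hba.le] at key
  rw [← ENNReal.ofReal_toReal hAfin]
  refine ENNReal.ofReal_le_ofReal (key.trans ?_)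
  calc C * ((volume (e '' A)).toReal / (e b - e a)) ^ c * (b - a)
      ≤ C * (exp (-t) * (b - a) / (e b - e a)) ^ c * (b - a) := by
        gcongr
        exact ENNReal.toReal_le_of_le_ofReal (by positivity) himage
    _ = C * ((b - a) / (e b - e a)) ^ c * (b - a) * exp (-c * t) := by
        rw [mul_div_assoc, Real.mul_rpow (by positivity) (by positivity), ← Real.exp_mul,
          show -t * c = -c * t by ring]
        ring

/-- The logarithmic derivative of a strongly quasisymmetric homeomorphism is locally integrable. -/
theorem integrableOn_log_deriv {e : ℝ ≃o ℝ} (he : StronglyQS e) (a b : ℝ) :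
    IntegrableOn (fun x => log (deriv e x)) (Ico a b) := by
  rcases le_or_gt b a with hba | hab
  · simp [Ico_eq_empty hba.not_gt]
  have hm : Measurable fun x => log (deriv e x) := (measurable_deriv e).log
  have hm' : Measurable fun x => max (-log (deriv e x)) 0 := hm.neg.max measurable_const
  have hIm := measurableSet_of_differentiableAt ℝ e
  refine ⟨hm.aestronglyMeasurable, ?_⟩
  have hpos : ∫⁻ x in Ioo a b, ENNReal.ofReal (deriv e x) < ∞ := by
    have hcongr : (Ioo a b ∩ {x | DifferentiableAt ℝ e x} : Set ℝ) =ᵐ[volume] Ioo a b := by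
      refine inter_ae_eq_left_of_ae_eq_univ (eventuallyEq_univ.2 e.monotone.ae_differentiableAt)
    rw [← setLIntegral_congr hcongr,
      lintegral_deriv_eq_volume_image e (measurableSet_Ioo.inter hIm) fun x hx => hx.2]
    refine (measure_mono (image_mono inter_subset_left)).trans_lt ?_
    rw [e.image_Ioo]
    exact measure_Ioo_lt_top
  have hneg : ∫⁻ x in Ioo a b, ENNReal.ofReal (max (-log (deriv e x)) 0) < ∞ := by
    have hnn : 0 ≤ fun x => max (-log (deriv e x)) 0 := fun x => le_max_right _ _
    rw [lintegral_eq_lintegral_meas_lt _ (ae_of_all _ hnn) hm'.aemeasurable]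
    obtain ⟨D, c, hc, h⟩ := exists_volume_deriv_lt_exp_le he hab
    refine lt_of_le_of_lt (setLIntegral_mono' measurableSet_Ioi fun t ht => ?_)
      (((exp_neg_integrableOn_Ioi 0 hc).const_mul D).lintegral_lt_top)
    refine le_trans ?_ (h t)
    rw [Measure.restrict_apply (measurableSet_lt measurable_const hm')]
    refine measure_mono_ae ?_
    filter_upwards [ae_deriv_pos he] with x hx hxt
    refine ⟨hxt.2, hx.1, ?_⟩
    have h1 : t < max (-log (deriv e x)) 0 := hxt.1
    have h2 : t < -log (deriv e x) := by
      rcases lt_max_iff.1 h1 with h | h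
      · exact h
      · exact absurd h (not_lt.2 (le_of_lt ht))
    rw [← Real.log_lt_iff_lt_exp hx.2]
    linarith
  rw [HasFiniteIntegral, setLIntegral_congr Ioo_ae_eq_Ico.symm]
  refine lt_of_le_of_lt (lintegral_mono_ae ?_) ((lintegral_add_left
    (measurable_deriv e).ennreal_ofReal _).trans_lt (ENNReal.add_lt_top.2 ⟨hpos, hneg⟩))
  filter_upwards [ae_restrict_of_ae (ae_deriv_pos he)] with x hx
  rw [← ENNReal.ofReal_add hx.2.le (le_max_right _ _), ← ofReal_norm, Real.norm_eq_abs]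
  refine ENNReal.ofReal_le_ofReal (abs_le'.2 ⟨?_, ?_⟩)
  · linarith [Real.log_le_sub_one_of_pos hx.2, le_max_right (-log (deriv e x)) 0]
  · linarith [hx.2, le_max_left (-log (deriv e x)) 0]

theorem mosc_congr_ae {u v : ℝ → ℝ} (h : u =ᵐ[volume] v) (a b : ℝ) : mosc u a b = mosc v a b := by
  have h' := ae_restrict_of_ae (s := Ioo a b) h
  have hc : intAvg u a b = intAvg v a b := by rw [intAvg, intAvg, integral_congr_ae h']
  rw [mosc, mosc, hc]
  congr 1
  exact integral_congr_ae (by filter_upwards [h'] with x hx; rw [hx])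

theorem mosc_sub_le {u v : ℝ → ℝ} {a b : ℝ} (hab : a < b) (hu : IntegrableOn u (Ico a b))
    (hv : IntegrableOn v (Ico a b)) :
    mosc (u - v) a b ≤ mosc u a b + mosc v a b := by
  have hba : 0 < b - a := by linarith
  replace hu := hu.mono_set Ioo_subset_Ico_self
  replace hv := hv.mono_set Ioo_subset_Ico_self
  have hc : intAvg (u - v) a b = intAvg u a b - intAvg v a b := by
    rw [intAvg, intAvg, intAvg, integral_sub' hu hv, mul_sub]
  have hi : ∀ {f : ℝ → ℝ}, IntegrableOn f (Ioo a b) → ∀ c : ℝ,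
      IntegrableOn (fun x => |f x - c|) (Ioo a b) :=
    fun hf c => (hf.sub (integrableOn_const (by simp))).abs
  rw [mosc, mosc, mosc, ← mul_add, ← integral_add (hi hu _) (hi hv _)]
  refine mul_le_mul_of_nonneg_left ?_ (by positivity)
  refine integral_mono (hi (hu.sub hv) _) ((hi hu _).add (hi hv _)) fun x => ?_
  simp only [hc, Pi.sub_apply]
  rw [show u x - v x - (intAvg u a b - intAvg v a b)
    = (u x - intAvg u a b) - (v x - intAvg v a b) by ring]
  exact abs_sub _ _

/-- The mean oscillation is at most twice the mean deviation from any constant. -/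
theorem mosc_le_of_lintegral_le {u : ℝ → ℝ} {a b c K : ℝ} (hab : a < b)
    (hu : IntegrableOn u (Ico a b)) (hK : 0 ≤ K)
    (h : ∫⁻ x in Ico a b, ‖u x - c‖ₑ ≤ ENNReal.ofReal (K * (b - a))) :
    mosc u a b ≤ 2 * K := by
  have hba : 0 < b - a := by linarith
  have h1 : ENNReal.ofReal (mosc u a b * (b - a)) ≤ ENNReal.ofReal (2 * K * (b - a)) := by
    rw [← lintegral_enorm_sub_intAvg hab hu]
    calc ∫⁻ x in Ico a b, ‖u x - intAvg u a b‖ₑ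
        ≤ ∫⁻ x in Ico a b, (‖u x - c‖ₑ + ‖intAvg u a b - c‖ₑ) := by
          refine lintegral_mono fun x => ?_
          rw [show u x - intAvg u a b = (u x - c) - (intAvg u a b - c) by ring]
          exact enorm_sub_le
      _ = (∫⁻ x in Ico a b, ‖u x - c‖ₑ) + ‖intAvg u a b - c‖ₑ * ENNReal.ofReal (b - a) := by
          rw [lintegral_add_right _ measurable_const, setLIntegral_const, Real.volume_Ico]
      _ ≤ ENNReal.ofReal (K * (b - a)) + ENNReal.ofReal (K * (b - a)) := by
          gcongr
          exact (enorm_intAvg_sub_mul_le hab hu c).trans h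
      _ = _ := by rw [← ENNReal.ofReal_add (by positivity) (by positivity)]; ring_nf
  rw [ENNReal.ofReal_le_ofReal_iff (by positivity)] at h1
  exact le_of_mul_le_mul_right h1 hba

theorem ae_comp_symm {e : ℝ ≃o ℝ} (he : StronglyQS e) {p : ℝ → Prop} (hp : ∀ᵐ x, p x) :
    ∀ᵐ y, p (e.symm y) :=
  ae_of_ae_map e.symm.continuous.measurable.aemeasurable
    (((stronglyQS_iff e).1 he).absolutelyContinuous.ae_le hp)

/-- Composition with the inverse of a strongly quasisymmetric homeomorphism is bounded
on `BMO`. -/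
theorem exists_mosc_comp_symm_le {e : ℝ ≃o ℝ} (he : StronglyQS e) :
    ∃ K : ℝ, 0 < K ∧ ∀ (v : ℝ → ℝ) (ε : ℝ), Measurable v → (∀ a b, IntegrableOn v (Ico a b)) →
      0 < ε → (∀ a b : ℝ, a < b → mosc v a b ≤ ε) →
      ∀ a b : ℝ, a < b → mosc (v ∘ e.symm) a b ≤ K * ε := by
  have hAC := (stronglyQS_iff e).1 he
  obtain ⟨δ, hδ, hδ1, h⟩ := hAC.exists_small (η := 2⁻¹) (by norm_num)
  refine ⟨8 / δ, by positivity, fun v ε hv hloc hε hosc a b hab => ?_⟩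
  have hab' : e.symm a < e.symm b := e.symm.strictMono hab
  set c := intAvg v (e.symm a) (e.symm b)
  rw [ENNReal.ofReal_inv_of_pos two_pos, ENNReal.ofReal_ofNat] at h
  have key := lintegral_oscillation_le hAC.absolutelyContinuous hδ hδ1 h hv hloc hε hosc hab'
  have hpre : e.symm ⁻¹' Ico (e.symm a) (e.symm b) = Ico a b := by
    rw [e.symm.preimage_Ico, e.symm_symm, e.apply_symm_apply, e.apply_symm_apply]
  rw [map_symm_Ico, e.apply_symm_apply, e.apply_symm_apply,
    setLIntegral_map measurableSet_Ico (hv.sub_const _).enorm e.symm.continuous.measurable,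
    hpre, show (4 : ℝ≥0∞) = ENNReal.ofReal 4 by simp, ← ENNReal.ofReal_mul (by norm_num),
    ← ENNReal.ofReal_mul (by positivity)] at key
  have hm : Measurable (v ∘ e.symm) := hv.comp e.symm.continuous.measurable
  have hint : IntegrableOn (fun x => v (e.symm x) - c) (Ico a b) :=
    ⟨(hm.sub_const c).aestronglyMeasurable, key.trans_lt ENNReal.ofReal_lt_top⟩
  have hu : IntegrableOn (v ∘ e.symm) (Ico a b) := by
    have := hint.add (integrableOn_const (C := c) (by simp : volume (Ico a b) ≠ ∞))
    refine this.congr (ae_of_all _ fun x => ?_)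
    simp
  refine (mosc_le_of_lintegral_le hab hu (by positivity) key).trans_eq ?_
  ring

theorem ae_log_deriv_comp_symm {f g : ℝ ≃o ℝ} (hf : StronglyQS f) (hg : StronglyQS g) :
    (fun y => log (deriv (g ∘ f.symm) y)) =ᵐ[volume]
      (fun x => log (deriv g x) - log (deriv f x)) ∘ f.symm := by
  filter_upwards [ae_comp_symm hf (ae_deriv_pos hf), ae_comp_symm hf (ae_deriv_pos hg)] with y hy hy'
  have hinv : HasDerivAt f.symm (deriv f (f.symm y))⁻¹ y :=
    HasDerivAt.of_local_left_inverse f.symm.continuous.continuousAt hy.1.hasDerivAt hy.2.ne'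
      (Eventually.of_forall f.apply_symm_apply)
  rw [(hy'.1.hasDerivAt.comp y hinv).deriv, ← div_eq_mul_inv, Real.log_div hy'.2.ne' hy.2.ne']
  rfl

/-- Strongly vanishing symmetric homeomorphisms are stable under `g ∘ f⁻¹`. -/
theorem memSS₀_comp_symm {f g : ℝ ≃o ℝ} (hf : MemSS₀ f) (hg : MemSS₀ g) : MemSS₀ (g ∘ f.symm) := by
  obtain ⟨-, -, -, hfQ, ⟨Mf, hMf⟩, hfC⟩ := hf
  obtain ⟨-, -, -, hgQ, ⟨Mg, hMg⟩, hgC⟩ := hg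
  obtain ⟨K, hK, hcomp⟩ := exists_mosc_comp_symm_le hfQ
  have hfm : Measurable fun x => log (deriv f x) := (measurable_deriv f).log
  have hgm : Measurable fun x => log (deriv g x) := (measurable_deriv g).log
  have hfi := integrableOn_log_deriv hfQ
  have hgi := integrableOn_log_deriv hgQ
  have hchain := ae_log_deriv_comp_symm hfQ hgQ
  refine ⟨g.strictMono.comp f.symm.strictMono, g.continuous.comp f.symm.continuous,
    g.surjective.comp f.symm.surjective, StronglyQS.comp hgQ (stronglyQS_symm hfQ),
    ⟨K * (|Mg| + |Mf| + 1), fun a b hab => ?_⟩, fun ε hε => ?_⟩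
  · rw [mosc_congr_ae hchain]
    refine hcomp _ _ (hgm.sub hfm) (fun a b => (hgi a b).sub (hfi a b)) (by positivity)
      (fun a b hab => ?_) a b hab
    refine (mosc_sub_le hab (hgi a b) (hfi a b)).trans ?_
    linarith [hMf a b hab, hMg a b hab, le_abs_self Mf, le_abs_self Mg]
  · obtain ⟨φ, hφ, hφc, hφε⟩ := hfC (ε / K / 2) (by positivity)
    obtain ⟨ψ, hψ, hψc, hψε⟩ := hgC (ε / K / 2) (by positivity)
    have hci : ∀ {k : ℝ → ℝ}, Continuous k → ∀ a b, IntegrableOn k (Ico a b) :=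
      fun hk a b => (hk.integrableOn_Icc).mono_set Ico_subset_Icc_self
    refine ⟨(ψ - φ) ∘ f.symm, (hψ.sub hφ).comp f.symm.continuous,
      (hψc.sub hφc).comp_homeomorph f.symm.toHomeomorph, fun a b hab => ?_⟩
    have hae : (fun x => log (deriv (g ∘ f.symm) x) - ((ψ - φ) ∘ f.symm) x) =ᵐ[volume]
        (fun x => (log (deriv g x) - ψ x) - (log (deriv f x) - φ x)) ∘ f.symm := by
      filter_upwards [hchain] with y hy
      simp only [hy, Function.comp_apply, Pi.sub_apply]
      ring
    have hgψ := fun a b => (hgi a b).sub (hci hψ a b)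
    have hfφ := fun a b => (hfi a b).sub (hci hφ a b)
    rw [mosc_congr_ae hae]
    refine (hcomp _ (ε / K) ((hgm.sub hψ.measurable).sub (hfm.sub hφ.measurable))
      (fun a b => (hgψ a b).sub (hfφ a b)) (by positivity) (fun a b hab => ?_) a b hab).trans_eq
      (mul_div_cancel₀ _ hK.ne')
    exact (mosc_sub_le hab (hgψ a b) (hfφ a b)).trans
      ((add_le_add (hψε a b hab) (hφε a b hab)).trans_eq (add_halves _))

end StronglyVanishing

theorem stmt12 (f g finv : ℝ → ℝ) (hf : MemSS₀ f) (hg : MemSS₀ g)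
    (hfinv : ∀ x, f (finv x) = x) (hfinv' : ∀ x, finv (f x) = x) :
    MemSS₀ (g ∘ finv) := by
  let F : ℝ ≃o ℝ := hf.1.orderIsoOfSurjective f hf.2.2.1
  let G : ℝ ≃o ℝ := hg.1.orderIsoOfSurjective g hg.2.2.1
  have hF : finv = F.symm := by
    funext x
    rw [← F.symm_apply_apply (finv x)]
    exact congrArg F.symm (hfinv x)
  rw [hF]
  exact StronglyVanishing.memSS₀_comp_symm (f := F) (g := G) hf hg
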